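/- The 44-point subset of PG(2,29) listed (as homogeneous coordinate triples over GF(29)) in the paper meets every line of PG(2,29) in at most 3 points; hence m_3(2,29) ≥ 44. -/

import Mathlib

open Projectivization

/-- The set of points of `PG(2,F)` lying on (the 2-dimensional subspace) `L`. -/
def linePoints (F : Type) [Field F] (L : Submodule F (Fin 3 → F)) :
    Set (Projectivization F (Fin 3 → F)) :=
  {p | p.submodule ≤ L}

/-- `L` is a line of `PG(2,F)`: a 2-dimensional subspace of `F³`. -/
def IsLine (F : Type) [Field F] (L : Submodule F (Fin 3 → F)) : Prop :=
  Module.finrank F L = 2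

/-- `B` meets every line of `PG(2,F)` in at most `r` points. -/
def MeetsLinesAtMost (F : Type) [Field F] (B : Set (Projectivization F (Fin 3 → F)))
    (r : ℕ) : Prop :=
  ∀ L : Submodule F (Fin 3 → F), IsLine F L → (B ∩ linePoints F L).ncard ≤ r

/-- `B` is an `(n,r)`-arc in `PG(2,F)`: a set of `n` points meeting every line in at
most `r` points, with some line meeting it in exactly `r` points. -/
def IsArc (F : Type) [Field F] (B : Set (Projectivization F (Fin 3 → F)))
    (n r : ℕ) : Prop :=
  B.ncard = n ∧ MeetsLinesAtMost F B r ∧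
    ∃ L : Submodule F (Fin 3 → F), IsLine F L ∧ (B ∩ linePoints F L).ncard = r

/-- `m_r(2,q)`: the maximum number `n` of points for which an `(n,r)`-arc in
`PG(2,F)` exists. -/
noncomputable def mArc (F : Type) [Field F] (r : ℕ) : ℕ :=
  sSup {n | ∃ B : Set (Projectivization F (Fin 3 → F)), IsArc F B n r}

instance : Fact (Nat.Prime 29) := ⟨by norm_num⟩

/-- The 44 homogeneous coordinate triples over `GF(29)` listed in the paper
(appendix, section `m_3(2,29) ≥ 44`). -/
def pts29 : Fin 44 → Fin 3 → ZMod 29 :=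
  ![![0,1,11], ![1,5,2], ![1,27,10], ![1,2,28], ![1,2,26], ![1,25,14], ![1,26,11],
    ![1,0,11], ![1,0,16], ![1,26,20], ![1,2,0], ![1,3,28], ![1,22,23], ![1,5,12],
    ![1,24,8], ![1,0,27], ![1,15,24], ![1,11,23], ![1,1,7], ![1,3,10], ![1,25,16],
    ![1,7,21], ![1,1,3], ![1,13,11], ![1,5,8], ![1,3,23], ![1,7,0], ![1,20,7],
    ![1,20,16], ![1,1,10], ![1,23,12], ![1,24,4], ![1,9,20], ![1,28,6], ![1,10,12],
    ![1,24,0], ![1,7,4], ![1,25,2], ![1,22,7], ![1,10,21], ![1,26,25], ![1,15,27],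
    ![1,22,13], ![1,21,20]]

open scoped Matrix

/-- `f x t` holds for every element `x` of the list, `t` being the part of the list after `x`. -/
def allTails {α : Type} (f : α → List α → Bool) : List α → Bool
  | [] => true
  | x :: l => f x l && allTails f l

theorem exists_tail_of_sublist {α : Type} {f : α → List α → Bool} {l : List α}
    (h : allTails f l = true) {x : α} {s : List α} (hs : (x :: s).Sublist l) :
    ∃ t, s.Sublist t ∧ f x t = true := by
  induction l with
  | nil => simp at hs
  | cons y l ih =>
    simp only [allTails, Bool.and_eq_true] at h
    cases hs with
    | cons _ hs => exact ih h.2 hs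
    | cons_cons _ hs => exact ⟨l, hs, h.1⟩

/-- Vanishing of the determinant of three vectors over `GF(29)`, tested on natural numbers. -/
def dependent (u v w : Fin 3 → ZMod 29) : Bool :=
  ((u 0).val * (v 1).val * (w 2).val + (u 1).val * (v 2).val * (w 0).val +
      (u 2).val * (v 0).val * (w 1).val) % 29 ==
    ((u 0).val * (v 2).val * (w 1).val + (u 1).val * (v 0).val * (w 2).val +
      (u 2).val * (v 1).val * (w 0).val) % 29

theorem dependent_iff_det_eq_zero (u v w : Fin 3 → ZMod 29) :
    dependent u v w = true ↔ Matrix.det (Matrix.of ![u, v, w]) = 0 := by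
  rw [dependent, beq_iff_eq, ← ZMod.natCast_eq_natCast_iff', ← sub_eq_zero, Matrix.det_fin_three]
  push_cast
  simp only [ZMod.natCast_val, ZMod.cast_id', id_eq]
  refine iff_of_eq (congrArg (· = 0) ?_)
  simp
  ring

theorem dependent_of_mem {L : Submodule (ZMod 29) (Fin 3 → ZMod 29)} (hL : IsLine (ZMod 29) L)
    {u v w : Fin 3 → ZMod 29} (hu : u ∈ L) (hv : v ∈ L) (hw : w ∈ L) :
    dependent u v w = true := by
  rw [dependent_iff_det_eq_zero]
  by_contra hdet
  have hrows : LinearIndependent (ZMod 29) ![u, v, w] :=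
    Matrix.linearIndependent_rows_iff_isUnit.2
      ((Matrix.isUnit_iff_isUnit_det _).2 (isUnit_iff_ne_zero.2 hdet))
  have hmem : ∀ i, ![u, v, w] i ∈ L := by
    intro i
    fin_cases i <;> assumption
  have hind : LinearIndependent (ZMod 29) fun i => (⟨![u, v, w] i, hmem i⟩ : L) :=
    LinearIndependent.of_comp L.subtype hrows
  have hcard := hind.fintype_card_le_finrank
  rw [hL] at hcard
  simp at hcard

theorem allTails_pts29 :
    allTails (fun u => allTails fun v => allTails fun w l =>
      !dependent u v w || l.all fun x => !dependent u v x) (List.ofFn pts29) = true := by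
  decide +kernel

theorem length_le_three_of_sublist {L : Submodule (ZMod 29) (Fin 3 → ZMod 29)}
    (hL : IsLine (ZMod 29) L) {s : List (Fin 3 → ZMod 29)} (hs : s.Sublist (List.ofFn pts29))
    (hmem : ∀ v ∈ s, v ∈ L) : s.length ≤ 3 := by
  match s with
  | [] | [_] | [_, _] | [_, _, _] => simp
  | u :: v :: w :: x :: s =>
    exfalso
    simp only [List.mem_cons, forall_eq_or_imp] at hmem
    obtain ⟨hu, hv, hw, hx, -⟩ := hmem
    obtain ⟨t, ht, h⟩ := exists_tail_of_sublist allTails_pts29 hs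
    obtain ⟨t, ht, h⟩ := exists_tail_of_sublist h ht
    obtain ⟨t, ht, h⟩ := exists_tail_of_sublist h ht
    have hxt : x ∈ t := ht.subset List.mem_cons_self
    simp only [dependent_of_mem hL hu hv hw, Bool.not_true, Bool.false_or, List.all_eq_true] at h
    simpa [dependent_of_mem hL hu hv hx] using h x hxt

theorem pts29_ne_smul {i j : Fin 44} (hij : i ≠ j) (a : ZMod 29) : a • pts29 j ≠ pts29 i := by
  have hcross : ∀ i j : Fin 44, i < j → pts29 i ⨯₃ pts29 j ≠ 0 := by decide +kernel
  intro h
  rcases hij.lt_or_gt with hlt | hlt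
  · exact hcross i j hlt (by rw [← h]; simp)
  · exact hcross j i hlt (by rw [← h]; simp)

theorem pts29_ne_zero (j : Fin 44) : pts29 j ≠ 0 := by
  obtain ⟨i, hi⟩ := exists_ne j
  exact fun h => pts29_ne_smul hi.symm 0 (by simp [h])

/-- The points of `PG(2,29)` with homogeneous coordinates `pts29`. -/
def arcPoint (j : Fin 44) : Projectivization (ZMod 29) (Fin 3 → ZMod 29) :=
  Projectivization.mk (ZMod 29) (pts29 j) (pts29_ne_zero j)

theorem arcPoint_injective : Function.Injective arcPoint := by
  intro i j h
  by_contra hij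
  obtain ⟨a, ha⟩ := (Projectivization.mk_eq_mk_iff' _ _ _ _ _).1 h
  exact pts29_ne_smul hij a ha

theorem arcPoint_mem_linePoints {L : Submodule (ZMod 29) (Fin 3 → ZMod 29)} {j : Fin 44} :
    arcPoint j ∈ linePoints (ZMod 29) L ↔ pts29 j ∈ L := by
  simp [arcPoint, linePoints, Projectivization.submodule_mk]

theorem meetsLinesAtMost_range_arcPoint :
    MeetsLinesAtMost (ZMod 29) (Set.range arcPoint) 3 := by
  classical
  intro L hL
  let s := (List.finRange 44).filter fun j => pts29 j ∈ L
  have hlen : s.length ≤ 3 := by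
    rw [← List.length_map (f := pts29)]
    refine length_le_three_of_sublist hL ?_ (by simp [s])
    rw [List.ofFn_eq_map]
    exact List.filter_sublist.map _
  have hset : Set.range arcPoint ∩ linePoints (ZMod 29) L = arcPoint '' (s.toFinset : Set _) := by
    ext p
    constructor
    · rintro ⟨⟨j, rfl⟩, hj⟩
      exact ⟨j, by simpa [s] using arcPoint_mem_linePoints.1 hj, rfl⟩
    · rintro ⟨j, hj, rfl⟩
      exact ⟨⟨j, rfl⟩, arcPoint_mem_linePoints.2 (by simpa [s] using hj)⟩
  rw [hset, Set.ncard_image_of_injective _ arcPoint_injective, Set.ncard_coe_finset]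
  exact (List.toFinset_card_le s).trans hlen

theorem exists_trisecant_range_arcPoint :
    ∃ L, IsLine (ZMod 29) L ∧ (Set.range arcPoint ∩ linePoints (ZMod 29) L).ncard = 3 := by
  have hind : LinearIndependent (ZMod 29) ![pts29 2, pts29 24] := by
    rw [LinearIndependent.pair_iff' (pts29_ne_zero 2)]
    exact fun a => pts29_ne_smul (by decide) a
  have hL : IsLine (ZMod 29) (Submodule.span (ZMod 29) (Set.range ![pts29 2, pts29 24])) := by
    simpa [IsLine] using finrank_span_eq_card hind
  refine ⟨_, hL, le_antisymm (meetsLinesAtMost_range_arcPoint _ hL) ?_⟩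
  have hsub : arcPoint '' (({2, 24, 43} : Finset (Fin 44)) : Set (Fin 44)) ⊆
      Set.range arcPoint ∩
        linePoints (ZMod 29) (Submodule.span (ZMod 29) (Set.range ![pts29 2, pts29 24])) := by
    rintro _ ⟨j, hj, rfl⟩
    refine ⟨⟨j, rfl⟩, arcPoint_mem_linePoints.2 ?_⟩
    rw [Matrix.range_cons, Matrix.range_cons, Matrix.range_empty, Set.union_empty,
      Set.singleton_union, Submodule.mem_span_pair]
    simp only [Finset.coe_insert, Finset.coe_singleton, Set.mem_insert_iff,
      Set.mem_singleton_iff] at hj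
    rcases hj with rfl | rfl | rfl
    · exact ⟨1, 0, by simp⟩
    · exact ⟨0, 1, by simp⟩
    · exact ⟨6, 24, by decide⟩
  calc 3 = (arcPoint '' (({2, 24, 43} : Finset (Fin 44)) : Set (Fin 44))).ncard := by
        rw [Set.ncard_image_of_injective _ arcPoint_injective, Set.ncard_coe_finset]
        rfl
    _ ≤ _ := Set.ncard_le_ncard hsub (Set.toFinite _)

theorem ncard_range_arcPoint : (Set.range arcPoint).ncard = 44 := by
  rw [← Set.image_univ, Set.ncard_image_of_injective _ arcPoint_injective, Set.ncard_univ]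
  simp

/-- The 44-point subset of `PG(2,29)` listed in the paper meets every line of
`PG(2,29)` in at most `3` points; hence `m_3(2,29) ≥ 44`. -/
theorem explicit_44_3_arc_in_PG2_29 :
    ∀ B : Set (Projectivization (ZMod 29) (Fin 3 → ZMod 29)),
      B = {p | ∃ j : Fin 44, ∃ h : pts29 j ≠ 0,
              p = Projectivization.mk (ZMod 29) (pts29 j) h} →
      B.ncard = 44 ∧ MeetsLinesAtMost (ZMod 29) B 3 ∧ 44 ≤ mArc (ZMod 29) 3 := by
  rintro B rfl
  have hB : {p | ∃ j : Fin 44, ∃ h : pts29 j ≠ 0,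
      p = Projectivization.mk (ZMod 29) (pts29 j) h} = Set.range arcPoint := by
    ext p
    exact ⟨fun ⟨j, _, hp⟩ => ⟨j, hp.symm⟩, fun ⟨j, hp⟩ => ⟨j, pts29_ne_zero j, hp.symm⟩⟩
  rw [hB]
  refine ⟨ncard_range_arcPoint, meetsLinesAtMost_range_arcPoint, le_csSup ?_
    ⟨_, ncard_range_arcPoint, meetsLinesAtMost_range_arcPoint, exists_trisecant_range_arcPoint⟩⟩
  refine ⟨Nat.card (Projectivization (ZMod 29) (Fin 3 → ZMod 29)), ?_⟩
  rintro _ ⟨B, rfl, -⟩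
  exact Set.ncard_le_card B
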